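/- arXiv:2006.16557 — 2 statements merged into one kernel-verified Lean document; each statement's English description precedes it below -/
import Mathlib

section
/- Fix integers N, K, r with 1 ≤ N ≤ K and 0 ≤ r ≤ K−1, and a demand type e : Fin N → ℕ with e(i) ≥ 1 for every i and ∑_i e(i) = K; let p be the number of indices i with e(i) = 1. Set F = 2·K·C(K−1, r) (the number of segments per file), m = 2·N·r·C(K−1, r) + 2·C(K−1, r) + m₃ where m₃ = 2·(N−1)·C(K−2, r−1) if r ≥ 1 and m₃ = 0 if r = 0, and T = 2·K·C(K−1, r+1) − 2·(K−p)·C(K−1−N, r+1) − 2·p·C(K−N, r+1), where all binomial coefficients use the convention C(a,b) = 0 whenever a < b or a < 0 (truncated natural subtraction realizes this here since r+1 ≥ 1). Then there exist cache-encoding functions φ_k : (Fin N → Fin F → ZMod 2) → (Fin m → ZMod 2), one for each user k : Fin K, and, for every demand vector d : Fin K → Fin N whose multiset of fiber sizes { |d⁻¹(i)| : i ∈ Fin N } equals the multiset { e(i) : i ∈ Fin N }, a broadcast-encoding function X_d : (Fin N → Fin F → ZMod 2) → (Fin T → ZMod 2) and decoding functions ψ_{d,k} : (Fin m → ZMod 2)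 → (Fin T → ZMod 2) → (Fin F → ZMod 2), such that ψ_{d,k}(φ_k(W))(X_d(W)) = W(d(k)) for every file realization W : Fin N → Fin F → ZMod 2 and every user k : Fin K. -/
/-- Number of segments per file: `F = 2·K·C(K−1, r)`. -/
def segCount (K r : ℕ) : ℕ := 2 * K * Nat.choose (K - 1) r

/-- Cache size (in segments): `m = 2·N·r·C(K−1,r) + 2·C(K−1,r) + m₃`,
where `m₃ = 2·(N−1)·C(K−2,r−1)` if `r ≥ 1` and `m₃ = 0` if `r = 0`. -/
def cacheCount (N K r : ℕ) : ℕ :=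
  2 * N * r * Nat.choose (K - 1) r + 2 * Nat.choose (K - 1) r +
    (if 1 ≤ r then 2 * (N - 1) * Nat.choose (K - 2) (r - 1) else 0)

/-- Broadcast size (in segments):
`T = 2·K·C(K−1,r+1) − 2·(K−p)·C(K−1−N,r+1) − 2·p·C(K−N,r+1)`,
with truncated natural subtraction realizing the convention `C(a,b) = 0` for `a < b` or `a < 0`. -/
def transCount (N K r p : ℕ) : ℕ :=
  2 * K * Nat.choose (K - 1) (r + 1)
    - 2 * (K - p) * Nat.choose (K - 1 - N) (r + 1)
    - 2 * p * Nat.choose (K - N) (r + 1)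

section CCHelpers
open Finset

/-- boundary lemma -/
lemma cc_boundary {ι F : Type*} [DecidableEq ι] [Field F] [CharP F 2]
    (U : Finset ι) (u : ι) (hu : u ∈ U) (r : ℕ) (f : Finset ι → F)
    (h : ∀ Q ⊆ U, u ∉ Q → Q.card + 1 = r → ∑ j ∈ U \ Q, f (insert j Q) = 0) :
    ∀ Q ⊆ U, Q.card + 1 = r → ∑ j ∈ U \ Q, f (insert j Q) = 0 := by
  intro Q hQ hc
  by_cases huQ : u ∈ Q
  swap
  · exact h Q hQ huQ hc
  set P := Q.erase u with hP
  have hPQ : insert u P = Q := insert_erase huQ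
  have huP : u ∉ P := notMem_erase u Q
  have hPU : P ⊆ U := (erase_subset _ _).trans hQ
  have key : ∑ i ∈ U \ P, ∑ j ∈ U \ (insert i P), f (insert j (insert i P)) = 0 := by
    rw [Finset.sum_sigma']
    refine Finset.sum_involution (fun x _ => ⟨x.2, x.1⟩) ?_ ?_ ?_ ?_
    · rintro ⟨i, j⟩ hij
      simp only
      rw [Finset.insert_comm]
      exact CharTwo.add_self_eq_zero _
    · rintro ⟨i, j⟩ hij _ heq
      simp at hij heq
      grind
    · rintro ⟨i, j⟩ hij
      simp at hij ⊢
      grind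
    · rintro ⟨i, j⟩ hij
      rfl
  have hmem : u ∈ U \ P := by simp [hu, huP]
  rw [← Finset.add_sum_erase _ _ hmem, hPQ] at key
  rw [Finset.sum_eq_zero (s := (U \ P).erase u), add_zero] at key
  · exact key
  · intro i hi
    simp at hi
    apply h
    · intro x; grind
    · grind
    · have : P.card + 1 = Q.card := by rw [← hPQ, card_insert_of_notMem huP]
      rw [card_insert_of_notMem hi.2.2]; omega

/-- transmitted combination -/
def ccY {ι ν F : Type*} [DecidableEq ι] [Field F] (d : ι → ν) (α : ι → F)
    (w : ν → Finset ι → F) (R : Finset ι) : F :=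
  ∑ j ∈ R, α j * w (d j) (R.erase j)

lemma cc_identity {ι ν F : Type*} [DecidableEq ι] [Fintype ι] [DecidableEq ν] [Field F] [CharP F 2]
    (d : ι → ν) (α : ι → F) (w : ν → Finset ι → F) (L B : Finset ι)
    (hinj : Set.InjOn d L) (hcov : ∀ j ∈ B, ∃ l ∈ L, d l = d j) :
    ∑ s ∈ (univ : Finset (L → ι)).filter (fun s => ∀ l : L, s l ∈ B ∧ d (s l) = d l),
      (∏ l, α (s l)) * ccY d α w (B \ univ.image s) = 0 := by
  classical
  have hcov' : ∀ j : ι, ∃ l : ι, j ∈ B → l ∈ L ∧ d l = d j := by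
    intro j
    by_cases hj : j ∈ B
    · obtain ⟨l, h1, h2⟩ := hcov j hj
      exact ⟨l, fun _ => ⟨h1, h2⟩⟩
    · exact ⟨j, fun h => absurd h hj⟩
  choose lam hlam using hcov'
  have hsinj : ∀ s : L → ι, (∀ l, s l ∈ B ∧ d (s l) = d l) → Function.Injective s := by
    intro s hs a b hab
    have := (hs a).2
    rw [hab, (hs b).2] at this
    exact Subtype.ext (hinj b.2 a.2 this).symm
  simp only [ccY, Finset.mul_sum]
  rw [Finset.sum_sigma']
  have hm : ∀ x ∈ ((univ : Finset (L → ι)).filter (fun s => ∀ l : L, s l ∈ B ∧ d (s l) = d l)).sigma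
      (fun s => B \ univ.image s), (∀ l, x.1 l ∈ B ∧ d (x.1 l) = d l) ∧ x.2 ∈ B ∧
        ∀ l, x.1 l ≠ x.2 := by
    rintro ⟨s, j⟩ hx
    simpa [mem_sigma, and_assoc] using hx
  let g : ∀ x ∈ ((univ : Finset (L → ι)).filter (fun s => ∀ l : L, s l ∈ B ∧ d (s l) = d l)).sigma
      (fun s => B \ univ.image s), (Σ _ : (L → ι), ι) := fun x hx =>
    ⟨Function.update x.1 ⟨lam x.2, (hlam x.2 (hm x hx).2.1).1⟩ x.2,
      x.1 ⟨lam x.2, (hlam x.2 (hm x hx).2.1).1⟩⟩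
  have hg1 : ∀ x hx, g x hx ∈ ((univ : Finset (L → ι)).filter
      (fun s => ∀ l : L, s l ∈ B ∧ d (s l) = d l)).sigma (fun s => B \ univ.image s) := by
    rintro ⟨s, j⟩ hx
    obtain ⟨h1, h2, h3⟩ := hm _ hx
    simp only at h1 h2 h3
    simp only [g, mem_sigma, mem_filter, mem_univ, true_and, mem_sdiff, mem_image, not_exists]
    refine ⟨?_, (h1 _).1, ?_⟩
    · intro l
      by_cases hl : l = ⟨lam j, (hlam j h2).1⟩
      · subst hl; simp [h2, (hlam j h2).2]
      · rw [Function.update_of_ne hl]; exact h1 l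
    · intro l
      by_cases hl : l = ⟨lam j, (hlam j h2).1⟩
      · subst hl; simpa using (h3 _).symm
      · rw [Function.update_of_ne hl]
        intro hh; exact hl (hsinj s h1 hh)
  refine Finset.sum_involution g ?_ ?_ hg1 ?_
  · rintro ⟨s, j⟩ hx
    obtain ⟨h1, h2, h3⟩ := hm _ hx
    simp only at h1 h2 h3
    set l0 : L := ⟨lam j, (hlam j h2).1⟩ with hl0
    have e1 : d (s l0) = d j := by rw [(h1 l0).2]; exact (hlam j h2).2
    have e2 : (B \ univ.image (Function.update s l0 j)).erase (s l0)
        = (B \ univ.image s).erase j := by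
      ext x
      simp only [mem_erase, mem_sdiff, mem_image, mem_univ, true_and, not_exists]
      constructor
      · rintro ⟨hx1, hx2, hx3⟩
        refine ⟨?_, hx2, ?_⟩
        · have := hx3 l0
          simp at this
          exact fun h => this h.symm
        · intro l
          by_cases hl : l = l0
          · subst hl; exact fun h => hx1 h.symm
          · have := hx3 l
            rwa [Function.update_of_ne hl] at this
      · rintro ⟨hx1, hx2, hx3⟩
        refine ⟨fun h => hx3 l0 h.symm, hx2, ?_⟩
        intro l
        by_cases hl : l = l0
        · subst hl; simpa using fun h => hx1 h.symm
        · rw [Function.update_of_ne hl]; exact hx3 l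
    have e3 : (∏ l, α (Function.update s l0 j l)) * α (s l0) = (∏ l, α (s l)) * α j := by
      rw [← Finset.mul_prod_erase univ _ (mem_univ l0),
        ← Finset.mul_prod_erase univ (fun l => α (s l)) (mem_univ l0)]
      rw [Finset.prod_congr rfl (g := fun l => α (s l))]
      · simp; ring
      · intro l hl
        rw [Function.update_of_ne (by simpa using hl)]
    simp only [g]
    rw [e2, e1, ← mul_assoc, ← mul_assoc, e3]
    exact CharTwo.add_self_eq_zero _
  · rintro ⟨s, j⟩ hx _ heq
    obtain ⟨h1, h2, h3⟩ := hm _ hx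
    have := congrArg (fun x => x.2) heq
    exact h3 _ this
  · rintro ⟨s, j⟩ hx
    obtain ⟨h1, h2, h3⟩ := hm _ hx
    simp only at h1 h2 h3
    have e : ∀ h, (⟨lam (s ⟨lam j, (hlam j h2).1⟩), h⟩ : L) = ⟨lam j, (hlam j h2).1⟩ := by
      intro h
      apply Subtype.ext
      apply hinj h (hlam j h2).1
      rw [(hlam _ (h1 _).1).2, (h1 _).2]
    simp only [g, e]
    simp

lemma cc_redund {ι ν F : Type*} [DecidableEq ι] [Fintype ι] [DecidableEq ν] [Field F] [CharP F 2]
    (d : ι → ν) (α : ι → F) (hα : ∀ j, α j ≠ 0) (w : ν → Finset ι → F) (L U : Finset ι) (t : ℕ)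
    (hLU : L ⊆ U) (hinj : Set.InjOn d L) (hcov : ∀ j ∈ U, ∃ l ∈ L, d l = d j)
    (h : ∀ R ⊆ U, R.card = t → ¬ Disjoint R L → ccY d α w R = 0) :
    ∀ R ⊆ U, R.card = t → ccY d α w R = 0 := by
  intro R hR ht
  by_cases hd : Disjoint R L
  swap
  · exact h R hR ht hd
  have hBU : R ∪ L ⊆ U := union_subset hR hLU
  have key := cc_identity d α w L (R ∪ L) hinj (fun j hj => hcov j (hBU hj))
  rw [Finset.sum_eq_single_of_mem (fun l : L => (l : ι))] at key
  · have e : (R ∪ L) \ univ.image (fun l : L => (l : ι)) = R := by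
      ext x
      have hx : x ∈ R → x ∉ L := fun h => Finset.disjoint_left.1 hd h
      simp
      tauto
    rw [e] at key
    exact (mul_eq_zero.1 key).resolve_left (Finset.prod_ne_zero_iff.2 fun l _ => hα _)
  · simp +contextual
  · intro s hs hne
    simp only [mem_filter, mem_univ, true_and] at hs
    have hsi : Function.Injective s := by
      intro a b hab
      have := (hs a).2
      rw [hab, (hs b).2] at this
      exact Subtype.ext (hinj b.2 a.2 this).symm
    have hsub : univ.image s ⊆ R ∪ L := by
      intro x hx
      simp only [mem_image, mem_univ, true_and] at hx
      obtain ⟨l, rfl⟩ := hx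
      exact (hs l).1
    have hc : (univ.image s).card = L.card := by
      rw [card_image_of_injective _ hsi]; simp
    rw [h, mul_zero]
    · exact sdiff_subset.trans hBU
    · rw [card_sdiff_of_subset hsub, hc, card_union_of_disjoint hd]; omega
    · intro hdis
      apply hne
      have hLs : L ⊆ univ.image s := by
        intro x hx
        by_contra hx'
        exact Finset.disjoint_left.1 hdis (mem_sdiff.2 ⟨mem_union_right _ hx, hx'⟩) hx
      have heq := Finset.eq_of_subset_of_card_le hLs hc.le
      funext l
      have : s l ∈ L := by rw [heq]; simp
      exact hinj this l.2 (hs l).2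

lemma cc_decode_other {ι ν F : Type*} [DecidableEq ι] [Field F]
    (d : ι → ν) (α : ι → F) (hα : ∀ j, α j ≠ 0) (w : ν → Finset ι → F) (U : Finset ι) (r : ℕ)
    (k : ι) (hk : k ∈ U)
    (hY : ∀ R ⊆ U, R.card = r + 1 → ccY d α w R = 0)
    (hw : ∀ n, ∀ S ⊆ U, S.card = r → k ∈ S → w n S = 0) :
    ∀ S ⊆ U, S.card = r → w (d k) S = 0 := by
  intro S hS hc
  by_cases hkS : k ∈ S
  · exact hw _ S hS hc hkS
  have := hY (insert k S) (insert_subset hk hS) (by rw [card_insert_of_notMem hkS, hc])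
  rw [ccY, sum_insert hkS, erase_insert hkS, Finset.sum_eq_zero, add_zero] at this
  · exact (mul_eq_zero.1 this).resolve_left (hα k)
  · intro j hj
    rw [hw, mul_zero]
    · exact (erase_subset _ _).trans (insert_subset hk hS)
    · rw [card_erase_of_mem (mem_insert_of_mem hj), card_insert_of_notMem hkS, hc]; rfl
    · simp only [mem_erase, mem_insert, true_or, and_true]
      rintro rfl; exact hkS hj

lemma cc_decode_self {ι ν F : Type*} [DecidableEq ι] [DecidableEq ν] [Fintype ν] [Field F]
    [CharP F 2]
    (d : ι → ν) (α : ι → F) (w : ν → Finset ι → F) (U : Finset ι) (r : ℕ) (n0 : ν)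
    (hY : ∀ R ⊆ U, R.card = r + 1 → ccY d α w R = 0)
    (hB : ∀ n, ∀ Q ⊆ U, Q.card + 1 = r → ∑ j ∈ U \ Q, w n (insert j Q) = 0)
    (hS : ∀ S ⊆ U, S.card = r → ∑ n, w n S = 0)
    (h1 : ∀ n, n ≠ n0 → ∑ j ∈ U with d j = n, α j = 1)
    (h0 : ∑ j ∈ U with d j = n0, α j ≠ 1) :
    ∀ S ⊆ U, S.card = r → w n0 S = 0 := by
  intro S hSU hc
  have key : ∑ j ∈ U, α j * w (d j) S = 0 := by
    have e0 : ∑ j ∈ U \ S, ccY d α w (insert j S) = 0 := by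
      apply Finset.sum_eq_zero
      intro j hj
      simp only [mem_sdiff] at hj
      exact hY _ (insert_subset hj.1 hSU) (by rw [card_insert_of_notMem hj.2, hc])
    have e1 : ∀ j ∈ U \ S, ccY d α w (insert j S) = α j * w (d j) S
        + ∑ i ∈ S, α i * w (d i) (insert j (S.erase i)) := by
      intro j hj
      simp only [mem_sdiff] at hj
      rw [ccY, sum_insert hj.2, erase_insert hj.2]
      congr 1
      apply Finset.sum_congr rfl
      intro i hi
      rw [erase_insert_of_ne]
      rintro rfl; exact hj.2 hi
    rw [Finset.sum_congr rfl e1, sum_add_distrib, Finset.sum_comm] at e0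
    have e2 : ∀ i ∈ S, ∑ j ∈ U \ S, α i * w (d i) (insert j (S.erase i)) = α i * w (d i) S := by
      intro i hi
      have hb := hB (d i) (S.erase i) ((erase_subset _ _).trans hSU)
        (by rw [card_erase_of_mem hi]; have := card_pos.2 ⟨i, hi⟩; omega)
      have hs : U \ S.erase i = insert i (U \ S) := by
        ext x
        have := @hSU x
        simp
        grind
      rw [hs, sum_insert (by simp [hi]), insert_erase hi] at hb
      rw [← Finset.mul_sum]
      congr 1
      exact (CharTwo.add_eq_zero.1 hb).symm
    rw [Finset.sum_congr rfl e2, Finset.sum_sdiff hSU] at e0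
    exact e0
  rw [← Finset.sum_fiberwise_of_maps_to (g := d) (t := univ) (fun _ _ => mem_univ _)] at key
  have e3 : ∀ n, ∑ j ∈ U with d j = n, α j * w (d j) S
      = (∑ j ∈ U with d j = n, α j) * w n S := by
    intro n
    rw [Finset.sum_mul]
    apply Finset.sum_congr rfl
    intro j hj
    rw [(mem_filter.1 hj).2]
  simp only [e3] at key
  have hs := hS S hSU hc
  rw [← Finset.add_sum_erase _ _ (mem_univ n0)] at key hs
  rw [Finset.sum_congr rfl (g := fun n => w n S)] at key
  · have : ((∑ j ∈ U with d j = n0, α j) - 1) * w n0 S = 0 := by linear_combination key - hs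
    exact (mul_eq_zero.1 this).resolve_left (sub_ne_zero.2 h0)
  · intro n hn
    rw [h1 n (ne_of_mem_erase hn), one_mul]

lemma cc_coef_aux {ι F : Type*} [DecidableEq ι] [Field F] (o : F) (h0 : o ≠ 0) (h1 : o ≠ 1)
    (A : Finset ι) (hA : A.Nonempty) : ∀ t : F, t ≠ 0 →
    ∃ α : ι → F, (∀ j, α j ≠ 0) ∧ ∑ j ∈ A, α j = t := by
  induction hA using Finset.Nonempty.cons_induction with
  | singleton a => intro t ht; exact ⟨fun _ => t, fun _ => ht, by simp⟩
  | cons a s ha hs ih =>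
    intro t ht
    obtain ⟨α, h2, h3⟩ := ih (t - o * t) (by
      have : t - o * t = (1 - o) * t := by ring
      rw [this]
      exact mul_ne_zero (sub_ne_zero.2 h1.symm) ht)
    refine ⟨Function.update α a (o * t), ?_, ?_⟩
    · intro j
      by_cases hj : j = a
      · subst hj; simp [h0, ht]
      · rw [Function.update_of_ne hj]; exact h2 j
    · rw [sum_cons, Function.update_self, Finset.sum_congr rfl (g := α), h3]
      · ring
      · intro j hj
        rw [Function.update_of_ne]
        rintro rfl; exact ha hj

lemma cc_coef {ι ν F : Type*} [DecidableEq ι] [DecidableEq ν] [Field F] (o : F) (h0 : o ≠ 0)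
    (h1 : o ≠ 1) (U : Finset ι) (d : ι → ν) (n0 : ν) (hd : ∀ n, n ≠ n0 → ∃ j ∈ U, d j = n) :
    ∃ α : ι → F, (∀ j, α j ≠ 0) ∧ (∀ n, n ≠ n0 → ∑ j ∈ U with d j = n, α j = 1) ∧
      ∑ j ∈ U with d j = n0, α j ≠ 1 := by
  have H : ∀ n, ∃ α : ι → F, (∀ j, α j ≠ 0) ∧ (n ≠ n0 → ∑ j ∈ U with d j = n, α j = 1) ∧
      (n = n0 → ∑ j ∈ U with d j = n, α j ≠ 1) := by
    intro n
    by_cases hn : n = n0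
    · subst hn
      by_cases hne : (U.filter (fun j => d j = n)).Nonempty
      · obtain ⟨α, ha, hb⟩ := cc_coef_aux o h0 h1 _ hne o h0
        exact ⟨α, ha, by simp, fun _ => by rw [hb]; exact h1⟩
      · rw [not_nonempty_iff_eq_empty] at hne
        exact ⟨fun _ => 1, by simp, by simp, by simp [hne]⟩
    · obtain ⟨j, hj, hj'⟩ := hd n hn
      obtain ⟨α, ha, hb⟩ := cc_coef_aux o h0 h1 (U.filter (fun j => d j = n))
        ⟨j, by simp [hj, hj']⟩ 1 one_ne_zero
      exact ⟨α, ha, fun _ => hb, fun h => absurd h hn⟩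
  choose a ha hb hc using H
  have e : ∀ n, ∑ j ∈ U with d j = n, a (d j) j = ∑ j ∈ U with d j = n, a n j := by
    intro n
    apply Finset.sum_congr rfl
    intro j hj
    rw [(mem_filter.1 hj).2]
  refine ⟨fun j => a (d j) j, fun j => ha _ _, ?_, ?_⟩
  · intro n hn; rw [e]; exact hb n hn
  · rw [e]; exact hc n0 rfl

lemma cc_leaders {ι ν : Type*} [DecidableEq ι] [DecidableEq ν] (U : Finset ι) (d : ι → ν) :
    ∃ L ⊆ U, Set.InjOn d L ∧ (∀ j ∈ U, ∃ l ∈ L, d l = d j) ∧ L.card = (U.image d).card := by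
  classical
  obtain ⟨s, hs, hb⟩ := Set.exists_subset_bijOn (U : Set ι) d
  have hfin : s.Finite := U.finite_toSet.subset hs
  lift s to Finset ι using hfin
  refine ⟨s, by exact_mod_cast hs, hb.injOn, ?_, ?_⟩
  · intro j hj
    obtain ⟨l, hl, hl'⟩ := hb.surjOn ⟨j, hj, rfl⟩
    exact ⟨l, hl, hl'⟩
  · have := hb.image_eq
    rw [← Finset.card_image_of_injOn hb.injOn]
    congr 1
    exact_mod_cast this

lemma cc_card_contains {ι : Type*} [DecidableEq ι] (A : Finset ι) (k : ι) (hk : k ∈ A) (r : ℕ) :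
    ((powersetCard r A).filter (fun S => k ∈ S)).card + (A.card - 1).choose r
      = A.card.choose r := by
  have h := Finset.card_filter_add_card_filter_not (s := powersetCard r A) (fun S => k ∈ S)
  have e : (powersetCard r A).filter (fun S => ¬ k ∈ S) = powersetCard r (A.erase k) := by
    ext S
    simp only [mem_filter, mem_powersetCard, subset_erase]
    tauto
  rw [e, card_powersetCard, card_powersetCard, card_erase_of_mem hk] at h
  exact h

lemma cc_card_meet {ι : Type*} [DecidableEq ι] (A L : Finset ι) (hL : L ⊆ A) (r : ℕ) :
    ((powersetCard r A).filter (fun S => ¬ Disjoint S L)).card + (A.card - L.card).choose r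
      = A.card.choose r := by
  have h := Finset.card_filter_add_card_filter_not (s := powersetCard r A) (fun S => Disjoint S L)
  have e : (powersetCard r A).filter (fun S => Disjoint S L) = powersetCard r (A \ L) := by
    ext S
    simp only [mem_filter, mem_powersetCard, subset_sdiff]
    tauto
  rw [e, card_powersetCard, card_powersetCard, card_sdiff_of_subset hL] at h
  omega

lemma cc_core {N K : ℕ} {F : Type*} [Field F] [CharP F 2] (r : ℕ)
    (d : Fin K → Fin N) (α : Fin K → Fin K → F) (L : Fin K → Finset (Fin K)) (ns : Fin N)
    (u : Fin K → Fin K) (hu : 1 ≤ r → ∀ k, u k ≠ k)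
    (hα : ∀ k j, α k j ≠ 0)
    (h1 : ∀ k n, n ≠ d k → ∑ j ∈ univ.erase k with d j = n, α k j = 1)
    (h0 : ∀ k, ∑ j ∈ univ.erase k with d j = d k, α k j ≠ 1)
    (hL1 : ∀ k, L k ⊆ univ.erase k) (hL2 : ∀ k, Set.InjOn d (L k))
    (hL3 : ∀ k, ∀ j ∈ univ.erase k, ∃ l ∈ L k, d l = d j)
    (v : Fin N → Fin K → Finset (Fin K) → F) (k : Fin K)
    (c1 : ∀ n, ∀ j ∈ univ.erase k, ∀ S ∈ powersetCard r (univ.erase j), k ∈ S → v n j S = 0)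
    (c2 : ∀ S ∈ powersetCard r (univ.erase k), ∑ n, v n k S = 0)
    (c3 : 1 ≤ r → ∀ n ∈ univ.erase ns, ∀ Q ∈ powersetCard (r - 1) ((univ.erase k).erase (u k)),
      ∑ j ∈ (univ.erase k) \ Q, v n k (insert j Q) = 0)
    (x : ∀ k', ∀ R ∈ powersetCard (r + 1) (univ.erase k'), ¬ Disjoint R (L k') →
      ccY d (α k') (fun n S => v n k' S) R = 0) :
    ∀ j, ∀ S ∈ powersetCard r (univ.erase j), v (d k) j S = 0 := by
  have hY : ∀ k', ∀ R ⊆ univ.erase k', R.card = r + 1 →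
      ccY d (α k') (fun n S => v n k' S) R = 0 := by
    intro k'
    apply cc_redund d (α k') (hα k') _ (L k') _ (r + 1) (hL1 k') (hL2 k') (hL3 k')
    intro R hR hc hd
    exact x k' R (mem_powersetCard.2 ⟨hR, hc⟩) hd
  intro j S hS
  rw [mem_powersetCard] at hS
  by_cases hj : j = k
  · subst hj
    refine cc_decode_self d (α j) (fun n S => v n j S) (univ.erase j) r (d j) (hY j) ?_ ?_
      (h1 j) (h0 j) S hS.1 hS.2
    · have hne : ∀ n, n ≠ ns → ∀ Q ⊆ univ.erase j, Q.card + 1 = r →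
          ∑ i ∈ univ.erase j \ Q, v n j (insert i Q) = 0 := by
        intro n hn Q hQ hc
        have hr : 1 ≤ r := by omega
        refine cc_boundary (univ.erase j) (u j) (by simp [hu hr j]) r (fun S => v n j S) ?_ Q hQ hc
        intro Q hQ huQ hc
        refine c3 hr n (by simp [hn]) Q ?_
        rw [mem_powersetCard, subset_erase]
        exact ⟨⟨hQ, huQ⟩, by omega⟩
      intro n Q hQ hc
      by_cases hn : n = ns
      · subst hn
        have e : ∑ n, ∑ i ∈ univ.erase j \ Q, v n j (insert i Q) = 0 := by
          rw [Finset.sum_comm]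
          apply Finset.sum_eq_zero
          intro i hi
          rw [mem_sdiff] at hi
          apply c2
          rw [mem_powersetCard]
          exact ⟨insert_subset hi.1 hQ, by rw [card_insert_of_notMem hi.2, hc]⟩
        rw [← Finset.add_sum_erase _ _ (mem_univ n), Finset.sum_eq_zero (s := univ.erase n), add_zero] at e
        · exact e
        · intro m hm
          exact hne m (ne_of_mem_erase hm) Q hQ hc
      · exact hne n hn Q hQ hc
    · intro S hS hc
      exact c2 S (mem_powersetCard.2 ⟨hS, hc⟩)
  · refine cc_decode_other d (α j) (hα j) (fun n S => v n j S) (univ.erase j) r k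
      (by simp [Ne.symm hj]) (hY j) ?_ S hS.1 hS.2
    intro n S hS hc hk
    exact c1 n j (by simp [hj]) S (mem_powersetCard.2 ⟨hS, hc⟩) hk

lemma cc_inj {A : Type*} [Finite A] (n : ℕ) (h : Nat.card A ≤ 2 ^ n) :
    ∃ f : A → (Fin n → ZMod 2), Function.Injective f := by
  have := Fintype.ofFinite A
  obtain ⟨f⟩ := Function.Embedding.nonempty_of_card_le (α := A) (β := Fin n → ZMod 2) (by
    rw [← Nat.card_eq_fintype_card]; simpa [ZMod.card] using h)
  exact ⟨f, f.injective⟩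

lemma cc_p {N K : ℕ} (e : Fin N → ℕ) (d : Fin K → Fin N)
    (h : (Multiset.map (fun i : Fin N => (Finset.univ.filter fun k : Fin K => d k = i).card)
            Finset.univ.val) = Multiset.map e Finset.univ.val) :
    (univ.filter fun i : Fin N => e i = 1).card =
      (univ.filter fun k : Fin K => ∀ j, d j = d k → j = k).card := by
  have h1 := congrArg (Multiset.count 1) h
  rw [Multiset.count_map, Multiset.count_map] at h1
  have h2 : (univ.filter fun i : Fin N => e i = 1).card =
      (univ.filter fun i : Fin N => (univ.filter fun k : Fin K => d k = i).card = 1).card := by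
    simp only [eq_comm (a := 1)] at h1
    exact h1.symm
  rw [h2]
  symm
  apply Finset.card_bij (fun k _ => d k)
  · intro k hk
    simp only [mem_filter, mem_univ, true_and] at hk ⊢
    rw [card_eq_one]
    refine ⟨k, ?_⟩
    ext j
    simp only [mem_filter, mem_univ, true_and, mem_singleton]
    exact ⟨hk j, fun h => by rw [h]⟩
  · intro a ha b hb hab
    simp only [mem_filter, mem_univ, true_and] at ha hb
    exact hb a hab
  · intro i hi
    simp only [mem_filter, mem_univ, true_and] at hi
    obtain ⟨k, hk⟩ := card_eq_one.1 hi
    have hk' : ∀ j, d j = i ↔ j = k := by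
      intro j
      have := congrArg (fun s => j ∈ s) hk
      simpa using this
    have hki := (hk' k).2 rfl
    refine ⟨k, ?_, hki⟩
    simp only [mem_filter, mem_univ, true_and]
    intro j hj
    exact (hk' j).1 (hj.trans hki)

lemma cc_surj {N K : ℕ} (e : Fin N → ℕ) (he : ∀ i, 1 ≤ e i) (d : Fin K → Fin N)
    (h : (Multiset.map (fun i : Fin N => (Finset.univ.filter fun k : Fin K => d k = i).card)
            Finset.univ.val) = Multiset.map e Finset.univ.val) :
    ∀ n, ∃ k, d k = n := by
  intro n
  have : (Finset.univ.filter fun k : Fin K => d k = n).card ∈ Multiset.map e Finset.univ.val := by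
    rw [← h]
    exact Multiset.mem_map.2 ⟨n, by simp, rfl⟩
  obtain ⟨i, _, hi⟩ := Multiset.mem_map.1 this
  have hp : 0 < (Finset.univ.filter fun k : Fin K => d k = n).card := by
    rw [← hi]; exact he i
  obtain ⟨k, hk⟩ := card_pos.1 hp
  exact ⟨k, by simpa using hk⟩

lemma cc_trans {N K : ℕ} (hN : 1 ≤ N) (r : ℕ) (d : Fin K → Fin N) (hs : ∀ n, ∃ k, d k = n)
    (L : Fin K → Finset (Fin K)) (hL1 : ∀ k, L k ⊆ univ.erase k)
    (hL4 : ∀ k, (L k).card = ((univ.erase k).image d).card) :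
    2 * ∑ k, ((powersetCard (r + 1) (univ.erase k)).filter (fun S => ¬ Disjoint S (L k))).card ≤
      transCount N K r (univ.filter fun k : Fin K => ∀ j, d j = d k → j = k).card := by
  set P := univ.filter fun k : Fin K => ∀ j, d j = d k → j = k with hP
  have hc : ∀ k : Fin K, ((univ : Finset (Fin K)).erase k).card = K - 1 := by
    intro k; rw [card_erase_of_mem (mem_univ k)]; simp
  have key : ∀ k : Fin K, ((powersetCard (r + 1) (univ.erase k)).filter
      (fun S => ¬ Disjoint S (L k))).card +
        (if k ∈ P then (K - N).choose (r + 1) else (K - 1 - N).choose (r + 1))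
      = (K - 1).choose (r + 1) := by
    intro k
    have := cc_card_meet (univ.erase k) (L k) (hL1 k) (r + 1)
    rw [hc, hL4] at this
    rw [← this]
    congr 1
    split_ifs with hk
    · have : (univ.erase k).image d = univ.erase (d k) := by
        ext n
        simp only [hP, mem_filter, mem_univ, true_and] at hk
        simp only [mem_image, mem_erase, mem_univ, and_true]
        constructor
        · rintro ⟨j, hj, rfl⟩ h
          exact hj (hk j h)
        · intro hn
          obtain ⟨j, rfl⟩ := hs n
          exact ⟨j, fun h => hn (by rw [h]), rfl⟩
      rw [this, card_erase_of_mem (mem_univ _), card_univ, Fintype.card_fin]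
      congr 1; omega
    · have : (univ.erase k).image d = univ := by
        ext n
        simp only [hP, mem_filter, mem_univ, true_and, not_forall] at hk
        obtain ⟨j, hj, hjk⟩ := hk
        simp only [mem_image, mem_erase, mem_univ, and_true, iff_true]
        obtain ⟨i, rfl⟩ := hs n
        by_cases hik : i = k
        · exact ⟨j, hjk, by rw [hj, hik]⟩
        · exact ⟨i, hik, rfl⟩
      rw [this, card_univ, Fintype.card_fin]
  have hsum := Finset.sum_congr (rfl : (univ : Finset (Fin K)) = univ) (fun k _ => key k)
  rw [sum_add_distrib, Finset.sum_ite, sum_const, sum_const, sum_const, card_univ,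
    Fintype.card_fin, filter_univ_mem] at hsum
  have hcompl : (univ.filter fun k => k ∉ P).card = K - P.card := by
    have := Finset.card_filter_add_card_filter_not (s := (univ : Finset (Fin K))) (fun k => k ∈ P)
    rw [filter_univ_mem, card_univ, Fintype.card_fin] at this
    omega
  rw [hcompl] at hsum
  simp only [smul_eq_mul] at hsum
  rw [transCount, mul_assoc, mul_assoc, mul_assoc]
  omega

lemma cc_cache {N K : ℕ} (r : ℕ) (k : Fin K) (u : Fin K) (hu : 1 ≤ r → u ≠ k) (ns : Fin N) :
    2 * (((univ : Finset (Fin N)) ×ˢ ((univ.erase k).sigma fun j =>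
        (powersetCard r (univ.erase j)).filter (fun S => k ∈ S))).card
      + (powersetCard r (univ.erase k)).card
      + (if 1 ≤ r then ((univ.erase ns) ×ˢ
          (powersetCard (r - 1) ((univ.erase k).erase u))) else ∅).card) = cacheCount N K r := by
  have hc : ∀ k : Fin K, ((univ : Finset (Fin K)).erase k).card = K - 1 := by
    intro k; rw [card_erase_of_mem (mem_univ k)]; simp
  have h1 : ((univ.erase k).sigma fun j =>
        (powersetCard r (univ.erase j)).filter (fun S => k ∈ S)).card = r * (K - 1).choose r := by
    rw [card_sigma, Finset.sum_congr rfl (g := fun _ => (K - 1).choose r - (K - 2).choose r)]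
    · rw [sum_const, hc, smul_eq_mul]
      rcases r with _ | r
      · simp
      · rcases hK : K with _ | _ | K
        · simp
        · simp
        · simp only [Nat.add_sub_cancel, Nat.reduceSubDiff, Nat.choose_succ_succ K r]
          have := Nat.add_one_mul_choose_eq K r
          simp only [Nat.succ_eq_add_one, Nat.choose_succ_succ] at this
          rw [mul_comm (r + 1)]
          convert this using 2
    · intro j hj
      have := cc_card_contains (univ.erase j) k (by simpa using (ne_of_mem_erase hj).symm) r
      rw [hc] at this
      have e : K - 1 - 1 = K - 2 := by omega
      rw [e] at this
      omega
  rw [card_product, h1, card_powersetCard, hc, card_univ, Fintype.card_fin, cacheCount]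
  split_ifs with hr
  · rw [card_product, card_powersetCard, card_erase_of_mem (mem_univ ns), card_univ,
      Fintype.card_fin, card_erase_of_mem (by simp [hu hr]), hc]
    have e : K - 1 - 1 = K - 2 := by omega
    rw [e]; ring
  · simp; ring

lemma cc_seg (K r : ℕ) : 2 * ((univ : Finset (Fin K)).sigma fun k =>
    powersetCard r (univ.erase k)).card = segCount K r := by
  rw [card_sigma, Finset.sum_congr rfl (g := fun _ => (K - 1).choose r)]
  · rw [sum_const, segCount]; simp; ring
  · intro k _
    rw [card_powersetCard, card_erase_of_mem (mem_univ k)]; simp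

lemma cc_card_fun {A F : Type*} [Finite F] (hF : Nat.card F = 4) (s : Finset A) :
    Nat.card (s → F) = 2 ^ (2 * s.card) := by
  rw [Nat.card_fun, hF, pow_mul]; simp

/-- extension by zero of the segment array -/
noncomputable def ccExt {N K : ℕ} {F : Type*} [Zero F] (r : ℕ)
    (w : Fin N → ((univ : Finset (Fin K)).sigma fun k => powersetCard r (univ.erase k)) → F)
    (n : Fin N) (k : Fin K) (S : Finset (Fin K)) : F :=
  if h : (⟨k, S⟩ : Σ _ : Fin K, Finset (Fin K)) ∈
    ((univ : Finset (Fin K)).sigma fun k => powersetCard r (univ.erase k)) then w n ⟨_, h⟩ else 0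

theorem cc_main
    (N K r : ℕ) (hN : 1 ≤ N) (hr : r ≤ K - 1)
    (e : Fin N → ℕ) (he : ∀ i, 1 ≤ e i) :
    ∃ φ : Fin K → (Fin N → Fin (segCount K r) → ZMod 2) →
        (Fin (cacheCount N K r) → ZMod 2),
      ∀ d : Fin K → Fin N,
        (Multiset.map (fun i : Fin N => (Finset.univ.filter fun k : Fin K => d k = i).card)
            Finset.univ.val)
          = Multiset.map e Finset.univ.val →
        ∃ X : (Fin N → Fin (segCount K r) → ZMod 2) →
            (Fin (transCount N K r ((Finset.univ.filter fun i : Fin N => e i = 1).card))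
              → ZMod 2),
        ∀ (W W' : Fin N → Fin (segCount K r) → ZMod 2) (k : Fin K),
            φ k W = φ k W' → X W = X W' → W (d k) = W' (d k) := by
  classical
  let F := GaloisField 2 2
  have hF : Nat.card F = 4 := by rw [GaloisField.card 2 2 (by norm_num)]; norm_num
  have hfinF : Finite F := Nat.finite_of_card_ne_zero (by rw [hF]; norm_num)
  obtain ⟨o, ho0, ho1⟩ : ∃ o : F, o ≠ 0 ∧ o ≠ 1 := by
    by_contra! hcon
    have := Fintype.ofFinite F
    have hle : (univ : Finset F).card ≤ ({0, 1} : Finset F).card := by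
      apply card_le_card
      intro x _
      by_cases hx : x = 0
      · simp [hx]
      · simp [hcon x hx]
    rw [card_univ, ← Nat.card_eq_fintype_card, hF] at hle
    have := hle.trans card_le_two
    omega
  have hu : ∃ u : Fin K → Fin K, 1 ≤ r → ∀ k, u k ≠ k := by
    by_cases h : 1 ≤ r
    · have : Nontrivial (Fin K) := Fin.nontrivial_iff_two_le.2 (by omega)
      choose u hu using fun k : Fin K => exists_ne k
      exact ⟨u, fun _ => hu⟩
    · exact ⟨id, fun h' => absurd h' h⟩
  obtain ⟨u, hu⟩ := hu
  let ns : Fin N := ⟨0, hN⟩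
  -- relabelling of files
  obtain ⟨E⟩ : Nonempty ((Fin (segCount K r) → ZMod 2) ≃
      (((univ : Finset (Fin K)).sigma fun k => powersetCard r (univ.erase k)) → F)) := by
    have := Fintype.ofFinite F
    refine ⟨Fintype.equivOfCardEq ?_⟩
    rw [← Nat.card_eq_fintype_card, ← Nat.card_eq_fintype_card, cc_card_fun hF, cc_seg]
    simp [ZMod.card]
  let G : (Fin N → Fin (segCount K r) → ZMod 2) → Fin N → Fin K → Finset (Fin K) → F :=
    fun W => ccExt r (fun n => E (W n))
  let C1 : Fin K → Finset (Fin N × (Σ _ : Fin K, Finset (Fin K))) := fun k =>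
    (univ : Finset (Fin N)) ×ˢ ((univ.erase k).sigma fun j =>
        (powersetCard r (univ.erase j)).filter (fun S => k ∈ S))
  let C2 : Fin K → Finset (Finset (Fin K)) := fun k => powersetCard r (univ.erase k)
  let C3 : Fin K → Finset (Fin N × Finset (Fin K)) := fun k =>
    if 1 ≤ r then ((univ.erase ns) ×ˢ (powersetCard (r - 1) ((univ.erase k).erase (u k)))) else ∅
  have hcache : ∀ k, ∃ f : ((C1 k → F) × (C2 k → F) × (C3 k → F)) →
      (Fin (cacheCount N K r) → ZMod 2), Function.Injective f := by
    intro k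
    apply cc_inj
    rw [Nat.card_prod, Nat.card_prod, cc_card_fun hF, cc_card_fun hF, cc_card_fun hF, ← pow_add,
      ← pow_add, ← cc_cache r k (u k) (fun h => hu h k) ns]
    apply le_of_eq
    congr 1
    simp only [C1, C2, C3]
    ring
  choose f hf using hcache
  let Φ : ∀ k, (Fin N → Fin K → Finset (Fin K) → F) → ((C1 k → F) × (C2 k → F) × (C3 k → F)) :=
    fun k v => (fun q => v q.1.1 q.1.2.1 q.1.2.2, fun S => ∑ n, v n k S.1,
      fun q => ∑ j ∈ (univ.erase k) \ q.1.2, v q.1.1 k (insert j q.1.2))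
  refine ⟨fun k W => f k (Φ k (G W)), ?_⟩
  intro d hd
  have hs := cc_surj e he d hd
  choose L hL1 hL2 hL3 hL4 using fun k : Fin K => cc_leaders (univ.erase k) d
  choose α hα h1 h0 using fun k : Fin K => cc_coef o ho0 ho1 (univ.erase k) d (d k) (by
    intro n hn
    obtain ⟨j, rfl⟩ := hs n
    exact ⟨j, by simpa using fun h => hn (by rw [h]), rfl⟩)
  let D : Finset (Σ _ : Fin K, Finset (Fin K)) := univ.sigma fun k =>
    (powersetCard (r + 1) (univ.erase k)).filter (fun S => ¬ Disjoint S (L k))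
  obtain ⟨g, hg⟩ : ∃ g : (D → F) → (Fin (transCount N K r
      ((Finset.univ.filter fun i : Fin N => e i = 1).card)) → ZMod 2), Function.Injective g := by
    apply cc_inj
    rw [cc_card_fun hF, cc_p e d hd]
    apply Nat.pow_le_pow_right (by norm_num)
    refine le_trans (le_of_eq ?_) (cc_trans hN r d hs L hL1 hL4)
    simp only [D, card_sigma]
  let Ξ : (Fin N → Fin K → Finset (Fin K) → F) → (D → F) := fun v q =>
    ccY d (α q.1.1) (fun n S => v n q.1.1 S) q.1.2
  refine ⟨fun W => g (Ξ (G W)), ?_⟩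
  intro W W' k hφ hX
  have hφ' := hf k hφ
  have hX' := hg hX
  simp only [Φ, Prod.mk.injEq] at hφ'
  obtain ⟨e1, e2, e3⟩ := hφ'
  have core := cc_core r d α L ns u hu hα h1 h0 hL1 hL2 hL3
    (fun n k S => G W n k S - G W' n k S) k ?_ ?_ ?_ ?_
  · apply E.injective
    funext q
    obtain ⟨⟨j, S⟩, hq⟩ := q
    have hq' : S ∈ powersetCard r (univ.erase j) := (mem_sigma.1 hq).2
    have := sub_eq_zero.1 (core j S hq')
    simp only [G, ccExt, dif_pos hq] at this
    exact this
  · intro n j hj S hS hk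
    have := congrFun e1 ⟨(n, ⟨j, S⟩), by
      simp only [C1, mem_product, mem_univ, true_and, mem_sigma, mem_filter]
      exact ⟨hj, hS, hk⟩⟩
    exact sub_eq_zero.2 this
  · intro S hS
    have := congrFun e2 ⟨S, hS⟩
    rw [sum_sub_distrib]
    exact sub_eq_zero.2 this
  · intro hr1 n hn Q hQ
    have := congrFun e3 ⟨(n, Q), by
      simp only [C3, if_pos hr1, mem_product]
      exact ⟨hn, hQ⟩⟩
    rw [sum_sub_distrib]
    exact sub_eq_zero.2 this
  · intro k' R hR hdis
    have := congrFun hX' ⟨⟨k', R⟩, by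
      simp only [D, mem_sigma, mem_univ, true_and, mem_filter]
      exact ⟨hR, hdis⟩⟩
    simp only [Ξ, ccY] at this
    simp only [ccY, mul_sub, sum_sub_distrib]
    exact sub_eq_zero.2 this

end CCHelpers

/-- Theorem 1: achievability for a single fully-demanding demand type `e`. -/
theorem single_demand_type_achievability
    (N K r : ℕ) (hN : 1 ≤ N) (hNK : N ≤ K) (hr : r ≤ K - 1)
    (e : Fin N → ℕ) (he : ∀ i, 1 ≤ e i) (hsum : ∑ i, e i = K) :
    ∃ φ : Fin K → (Fin N → Fin (segCount K r) → ZMod 2) →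
        (Fin (cacheCount N K r) → ZMod 2),
      ∀ d : Fin K → Fin N,
        (Multiset.map (fun i : Fin N => (Finset.univ.filter fun k : Fin K => d k = i).card)
            Finset.univ.val)
          = Multiset.map e Finset.univ.val →
        ∃ X : (Fin N → Fin (segCount K r) → ZMod 2) →
            (Fin (transCount N K r ((Finset.univ.filter fun i : Fin N => e i = 1).card))
              → ZMod 2),
        ∃ ψ : Fin K → (Fin (cacheCount N K r) → ZMod 2) →
            (Fin (transCount N K r ((Finset.univ.filter fun i : Fin N => e i = 1).card))
              → ZMod 2) →
            (Fin (segCount K r) → ZMod 2),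
          ∀ (W : Fin N → Fin (segCount K r) → ZMod 2) (k : Fin K),
            ψ k (φ k W) (X W) = W (d k) := by
  obtain ⟨φ, h⟩ := cc_main N K r hN hr e he
  refine ⟨φ, fun d hd => ?_⟩
  obtain ⟨X, hX⟩ := h d hd
  classical
  refine ⟨X, fun k c x => if hW : ∃ W, φ k W = c ∧ X W = x then hW.choose (d k) else 0, ?_⟩
  intro W k
  have hW : ∃ W', φ k W' = φ k W ∧ X W' = X W := ⟨W, rfl, rfl⟩
  simp only [dif_pos hW]
  exact hX _ _ k hW.choose_spec.1 hW.choose_spec.2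
end

section
/- Fix integers N, K, r with 1 ≤ N ≤ K and 0 ≤ r ≤ K−1. Let p* = max(2N − K, 0), F = 2·K·C(K−1, r), m = 2·N·r·C(K−1, r) + 2·C(K−1, r) + m₃ where m₃ = 2·(N−1)·C(K−2, r−1) if r ≥ 1 and m₃ = 0 if r = 0, and T* = 2·K·C(K−1, r+1) − 2·(K−p*)·C(K−1−N, r+1) − 2·p*·C(K−N, r+1), with the convention C(a,b) = 0 whenever a < b or a < 0. Then there exist cache-encoding functions φ_k : (Fin N → Fin F → ZMod 2) → (Fin m → ZMod 2), one for each user k : Fin K and independent of the demand, such that for every surjective demand vector d : Fin K → Fin N there exist a broadcast-encoding function X_d : (Fin N → Fin F → ZMod 2) → (Fin T* → ZMod 2) and decoding functions ψ_{d,k} : (Fin m → ZMod 2) → (Fin T* → ZMod 2) → (Fin F → ZMod 2) with ψ_{d,k}(φ_k(W))(X_d(W)) = W(d(k)) for every file realization W : Fin N → Fin F → ZMod 2 and every user k : Fin K. -/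
/-- Broadcast size (in segments) for `p* = max(2N − K, 0)` (realized by truncated
natural subtraction `2*N - K`):
`T* = 2·K·C(K−1,r+1) − 2·(K−p*)·C(K−1−N,r+1) − 2·p*·C(K−N,r+1)`,
with truncated natural subtraction realizing the convention `C(a,b) = 0` for `a < b` or `a < 0`. -/
def transCountStar (N K r : ℕ) : ℕ :=
  2 * K * Nat.choose (K - 1) (r + 1)
    - 2 * (K - (2 * N - K)) * Nat.choose (K - 1 - N) (r + 1)
    - 2 * (2 * N - K) * Nat.choose (K - N) (r + 1)


set_option linter.unusedSectionVars false

namespace CC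

/-- Reduction to finite alphabets and an injectivity criterion. -/
lemma reduction {N K F m t : ℕ} {S : Type} [Finite S] (hS : Nat.card S = 2 ^ F)
    (C : Fin K → Type) [∀ k, Finite (C k)] (hC : ∀ k, Nat.card (C k) ≤ 2 ^ m)
    (φ : ∀ k, (Fin N → S) → C k)
    (T : (Fin K → Fin N) → Type) [∀ d, Finite (T d)]
    (hT : ∀ d, Function.Surjective d → Nat.card (T d) ≤ 2 ^ t)
    (X : ∀ d, (Fin N → S) → T d)
    (det : ∀ d, Function.Surjective d → ∀ k W W', φ k W = φ k W' → X d W = X d W' →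
      W (d k) = W' (d k)) :
    ∃ φ : Fin K → (Fin N → Fin F → ZMod 2) → (Fin m → ZMod 2),
      ∀ d : Fin K → Fin N, Function.Surjective d →
        ∃ X : (Fin N → Fin F → ZMod 2) → (Fin t → ZMod 2),
        ∃ ψ : Fin K → (Fin m → ZMod 2) → (Fin t → ZMod 2) → (Fin F → ZMod 2),
          ∀ (W : Fin N → Fin F → ZMod 2) (k : Fin K), ψ k (φ k W) (X W) = W (d k) := by
  classical
  have cardZ : ∀ n : ℕ, Nat.card (Fin n → ZMod 2) = 2 ^ n := by
    intro n; simp [Nat.card_eq_fintype_card]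
  have emb : ∀ (A : Type) [Finite A] (n : ℕ), Nat.card A ≤ 2 ^ n →
      ∃ f : A → (Fin n → ZMod 2), Function.Injective f := by
    intro A _ n h
    have := Fintype.ofFinite A
    rw [Nat.card_eq_fintype_card] at h
    have : Fintype.card A ≤ Fintype.card (Fin n → ZMod 2) := by
      rw [← Nat.card_eq_fintype_card (α := Fin n → ZMod 2), cardZ]; exact h
    obtain ⟨f⟩ := Function.Embedding.nonempty_of_card_le this
    exact ⟨f, f.injective⟩
  have e : (Fin F → ZMod 2) ≃ S := (Finite.equivFinOfCardEq (cardZ F)).trans (Finite.equivFinOfCardEq hS).symm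
  choose fC hfC using fun k => emb (C k) m (hC k)
  refine ⟨fun k W => fC k (φ k (fun n => e (W n))), fun d hd => ?_⟩
  obtain ⟨fT, hfT⟩ := emb (T d) t (hT d hd)
  refine ⟨fun W => fT (X d (fun n => e (W n))), fun k a b =>
    if h : ∃ W : Fin N → Fin F → ZMod 2, fC k (φ k (fun n => e (W n))) = a ∧
      fT (X d (fun n => e (W n))) = b then h.choose (d k) else 0, ?_⟩
  intro W k
  have h : ∃ W' : Fin N → Fin F → ZMod 2,
      fC k (φ k (fun n => e (W' n))) = fC k (φ k (fun n => e (W n))) ∧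
      fT (X d (fun n => e (W' n))) = fT (X d (fun n => e (W n))) := ⟨W, rfl, rfl⟩
  dsimp only
  rw [dif_pos h]
  have := det d hd k _ _ (hfC k h.choose_spec.1) (hfT h.choose_spec.2)
  exact e.injective this

open Finset

variable {V R : Type} [Fintype V] [DecidableEq V] [Field R] [CharP R 2]

/-- exterior-type multiplication -/
def opE (u : V → R) (f : Finset V → R) (A : Finset V) : R :=
  ∑ j ∈ A, u j * f (A.erase j)

/-- boundary -/
def opD (f : Finset V → R) (B : Finset V) : R :=
  ∑ j ∈ Bᶜ, f (insert j B)

lemma opE_comm (u v : V → R) (f : Finset V → R) : opE u (opE v f) = opE v (opE u f) := by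
  funext A
  simp only [opE, mul_sum]
  rw [sum_sigma', sum_sigma']
  refine sum_bij' (fun x _ => ⟨x.2, x.1⟩) (fun x _ => ⟨x.2, x.1⟩) ?_ ?_ ?_ ?_ ?_
  · rintro ⟨a, b⟩ h
    simp only [mem_sigma, mem_erase] at h ⊢; exact ⟨h.2.2, h.2.1.symm, h.1⟩
  · rintro ⟨a, b⟩ h
    simp only [mem_sigma, mem_erase] at h ⊢; exact ⟨h.2.2, h.2.1.symm, h.1⟩
  · intros; rfl
  · intros; rfl
  · rintro ⟨a, b⟩ h
    simp only [erase_right_comm (a := b) (b := a)]; ring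

lemma opE_self (u : V → R) (f : Finset V → R) : opE u (opE u f) = 0 := by
  funext A
  simp only [opE, mul_sum]
  rw [sum_sigma']
  refine sum_involution (fun x _ => ⟨x.2, x.1⟩) ?_ ?_ ?_ ?_
  · rintro ⟨a, b⟩ h
    simp only [erase_right_comm (a := b) (b := a)]
    rw [mul_left_comm, CharTwo.add_self_eq_zero]
  · rintro ⟨a, b⟩ h _ h2
    simp only [mem_sigma, mem_erase] at h
    simp only [Sigma.mk.injEq] at h2
    exact h.2.1 h2.1
  · rintro ⟨a, b⟩ h
    simp only [mem_sigma, mem_erase] at h ⊢; exact ⟨h.2.2, h.2.1.symm, h.1⟩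
  · intros; rfl

lemma opD_self (f : Finset V → R) : opD (opD f) = 0 := by
  funext A
  simp only [opD]
  rw [sum_sigma']
  refine sum_involution (fun x _ => ⟨x.2, x.1⟩) ?_ ?_ ?_ ?_
  · rintro ⟨a, b⟩ h
    simp only [insert_comm b a]
    rw [CharTwo.add_self_eq_zero]
  · rintro ⟨a, b⟩ h _ h2
    simp only [mem_sigma, mem_compl, mem_insert, not_or] at h
    simp only [Sigma.mk.injEq] at h2
    exact h.2.1 h2.1
  · rintro ⟨a, b⟩ h
    simp only [mem_sigma, mem_compl, mem_insert, not_or] at h ⊢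
    exact ⟨h.2.2, fun h' => h.2.1 h'.symm, h.1⟩
  · intros; rfl

lemma opD_opE (u : V → R) (f : Finset V → R) (B : Finset V) :
    opD (opE u f) B + opE u (opD f) B = (∑ j, u j) * f B := by
  have h1 : opD (opE u f) B = (∑ l ∈ Bᶜ, u l) * f B +
      ∑ l ∈ Bᶜ, ∑ j ∈ B, u j * f (insert l (B.erase j)) := by
    simp only [opD, opE]
    rw [sum_mul, ← sum_add_distrib]
    refine sum_congr rfl fun l hl => ?_
    have hl' : l ∉ B := by simpa using hl
    rw [sum_insert hl', erase_insert hl']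
    congr 1
    refine sum_congr rfl fun j hj => ?_
    rw [erase_insert_of_ne]
    rintro rfl; exact hl' hj
  have h2 : opE u (opD f) B = (∑ l ∈ B, u l) * f B +
      ∑ l ∈ Bᶜ, ∑ j ∈ B, u j * f (insert l (B.erase j)) := by
    simp only [opD, opE]
    rw [sum_comm, sum_mul, ← sum_add_distrib]
    refine sum_congr rfl fun j hj => ?_
    have : (B.erase j)ᶜ = insert j Bᶜ := by
      ext x; simp only [mem_compl, mem_erase, mem_insert]; tauto
    rw [this, sum_insert (by simpa using hj), insert_erase hj, mul_add, mul_sum]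
  rw [h1, h2, ← sum_add_sum_compl B u, add_mul]
  have := CharTwo.add_self_eq_zero (∑ l ∈ Bᶜ, ∑ j ∈ B, u j * f (insert l (B.erase j)))
  linear_combination this

lemma opE_sum {ι : Type} (s : Finset ι) (u : V → R) (f : ι → Finset V → R) :
    opE u (∑ n ∈ s, f n) = ∑ n ∈ s, opE u (f n) := by
  funext A
  simp only [opE, Finset.sum_apply, mul_sum]
  exact sum_comm

lemma opE_add (u : V → R) (f g : Finset V → R) :
    opE u (f + g) = opE u f + opE u g := by
  funext A
  simp only [opE, Pi.add_apply, mul_add, sum_add_distrib]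

lemma opE_zero (u : V → R) : opE u (0 : Finset V → R) = 0 := by
  funext A
  simp [opE]

lemma opD_sum {ι : Type} (s : Finset ι) (f : ι → Finset V → R) :
    opD (∑ n ∈ s, f n) = ∑ n ∈ s, opD (f n) := by
  funext A
  simp only [opD, Finset.sum_apply]
  exact sum_comm

lemma opD_zero : opD (0 : Finset V → R) = 0 := by
  funext A
  simp [opD]

/-- Yu--Maddah-Ali--Avestimehr redundancy. -/
lemma redundancy {ι : Type} [DecidableEq ι] (u : ι → V → R) (ℓ : ι → V) (s : Finset ι)
    (hℓ : ∀ n ∈ s, u n (ℓ n) ≠ 0) (hdisj : ∀ n m j, u n j ≠ 0 → u m j ≠ 0 → n = m) :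
    ∀ (w : ι → Finset V → R),
      (∀ A, ∀ n ∈ s, ℓ n ∈ A → (∑ n ∈ s, opE (u n) (w n)) A = 0) →
      ∑ n ∈ s, opE (u n) (w n) = 0 := by
  induction s using Finset.induction_on with
  | empty => intro w _; simp
  | insert m s hm ih =>
    intro w h
    set f := ∑ n ∈ insert m s, opE (u n) (w n) with hf
    have hEf : opE (u m) f = ∑ n ∈ s, opE (u n) (opE (u m) (w n)) := by
      rw [hf, sum_insert hm, opE_add, opE_self, zero_add, opE_sum]
      exact sum_congr rfl fun n _ => opE_comm _ _ _
    have hE0 : opE (u m) f = 0 := by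
      rw [hEf]
      apply ih (fun n hn => hℓ n (mem_insert_of_mem hn))
      intro A n hn hA
      rw [← hEf]
      refine sum_eq_zero fun j hj => ?_
      by_cases hu : u m j = 0
      · rw [hu, zero_mul]
      · rw [h (A.erase j) n (mem_insert_of_mem hn), mul_zero]
        refine mem_erase.2 ⟨?_, hA⟩
        rintro rfl
        have := hdisj _ _ _ hu (hℓ n (mem_insert_of_mem hn))
        exact hm (this ▸ hn)
    funext A
    by_cases hA : ℓ m ∈ A
    · exact h A m (mem_insert_self _ _) hA
    · have := congrFun hE0 (insert (ℓ m) A)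
      rw [opE, sum_insert hA, erase_insert hA, sum_eq_zero, add_zero] at this
      · exact (mul_eq_zero.1 this).resolve_left (hℓ m (mem_insert_self _ _))
      · intro j hj
        rw [h _ m (mem_insert_self _ _), mul_zero]
        refine mem_erase.2 ⟨?_, mem_insert_self _ _⟩
        rintro rfl; exact hA hj

/-- Delivered symbol. -/
def opY {N K : ℕ} (d : Fin K → Fin N) (c : Fin K → R) (w : Fin N → Finset (Fin K) → R)
    (A : Finset (Fin K)) : R :=
  ∑ j ∈ A, c j * w (d j) (A.erase j)

lemma opY_eq {N K : ℕ} (d : Fin K → Fin N) (c : Fin K → R) (w : Fin N → Finset (Fin K) → R) :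
    opY d c w = ∑ n, opE (fun j => if d j = n then c j else 0) (w n) := by
  funext A
  simp only [opY, opE, Finset.sum_apply, ite_mul, zero_mul]
  rw [sum_comm]
  simp

/-- Admissible coefficients and leaders for the block `i`. -/
structure Good {N K : ℕ} (d : Fin K → Fin N) (i : Fin K) (c : Fin K → R)
    (P : Finset (Fin N)) (ℓ : Fin N → Fin K) : Prop where
  self : c i = 0
  ne : ∀ j, j ≠ i → c j ≠ 0
  memP : ∀ n, n ∈ P ↔ ∃ j, j ≠ i ∧ d j = n
  lead : ∀ n ∈ P, ℓ n ≠ i ∧ d (ℓ n) = n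
  sum_ne : ∀ n, n ≠ d i → ∑ j, (if d j = n then c j else 0) = 1
  sum_self : ∑ j, (if d j = d i then c j else 0) ≠ 1

lemma Y_zero {N K r : ℕ} {d : Fin K → Fin N} {i : Fin K} {c : Fin K → R}
    {P : Finset (Fin N)} {ℓ : Fin N → Fin K} (G : Good d i c P ℓ)
    (w : Fin N → Finset (Fin K) → R) (hsupp : ∀ n S, w n S ≠ 0 → i ∉ S ∧ S.card = r)
    (hX : ∀ A : Finset (Fin K), A.card = r + 1 → i ∉ A → ¬ Disjoint A (P.image ℓ) →
      opY d c w A = 0) : opY d c w = 0 := by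
  have key : opY d c w = ∑ n ∈ P, opE (fun j => if d j = n then c j else 0) (w n) := by
    rw [opY_eq]
    symm
    apply sum_subset (subset_univ _)
    intro n _ hn
    funext A
    refine sum_eq_zero fun j _ => ?_
    dsimp only
    split_ifs with h
    · by_cases hj : j = i
      · rw [hj, G.self, zero_mul]
      · exact absurd ((G.memP n).2 ⟨j, hj, h⟩) hn
    · rw [zero_mul]
  rw [key]
  apply redundancy (fun n j => if d j = n then c j else 0) ℓ
  · intro n hn
    have := G.lead n hn
    rw [if_pos this.2]; exact G.ne _ this.1
  · intro n m j hn hm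
    have h1 : d j = n := by by_contra h; simp [h] at hn
    have h2 : d j = m := by by_contra h; simp [h] at hm
    rw [← h1, h2]
  · intro A n hn hA
    rw [← key]
    by_cases h1 : i ∈ A
    · refine sum_eq_zero fun j hj => ?_
      by_cases hj : j = i
      · rw [hj, G.self, zero_mul]
      · by_contra h
        exact (hsupp _ _ (right_ne_zero_of_mul h)).1 (mem_erase.2 ⟨Ne.symm hj, h1⟩)
    by_cases h2 : A.card = r + 1
    · apply hX A h2 h1
      rw [not_disjoint_iff]
      exact ⟨ℓ n, hA, mem_image_of_mem _ hn⟩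
    · refine sum_eq_zero fun j hj => ?_
      by_contra h
      have := (hsupp _ _ (right_ne_zero_of_mul h)).2
      rw [card_erase_of_mem hj] at this
      have : 0 < A.card := card_pos.2 ⟨j, hj⟩
      omega

lemma core {N K r : ℕ} (d : Fin K → Fin N) (k j0 : Fin K) (n0 : Fin N)
    (c : Fin K → Fin K → R) (P : Fin K → Finset (Fin N)) (ℓ : Fin K → Fin N → Fin K)
    (G : ∀ i, Good d i (c i) (P i) (ℓ i))
    (w : Fin N → Fin K → Finset (Fin K) → R)
    (hsupp : ∀ n i S, w n i S ≠ 0 → i ∉ S ∧ S.card = r)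
    (h1 : ∀ n i S, i ∉ S → S.card = r → k ∈ S → w n i S = 0)
    (h2 : ∀ S, k ∉ S → S.card = r → ∑ n, w n k S = 0)
    (h3 : ∀ n B, n ≠ n0 → k ∉ B → j0 ∉ B → B.card + 1 = r → opD (w n k) B = 0)
    (hX : ∀ i, ∀ A : Finset (Fin K), A.card = r + 1 → i ∉ A →
      ¬ Disjoint A ((P i).image (ℓ i)) → opY d (c i) (fun n => w n i) A = 0)
    (i : Fin K) (S : Finset (Fin K)) : w (d k) i S = 0 := by
  have Y0 : ∀ i, opY d (c i) (fun n => w n i) = 0 := fun i =>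
    Y_zero (r := r) (G i) _ (fun n S => hsupp n i S) (hX i)
  have h1' : ∀ n i S, k ∈ S → w n i S = 0 := by
    intro n i S hk
    by_contra h
    exact h (h1 n i S (hsupp _ _ _ h).1 (hsupp _ _ _ h).2 hk)
  by_cases hik : i = k
  · subst hik
    have h2' : ∑ n, w n i = 0 := by
      funext S
      rw [Finset.sum_apply]
      by_cases hS : i ∉ S ∧ S.card = r
      · exact h2 S hS.1 hS.2
      · refine sum_eq_zero fun n _ => ?_
        by_contra h; exact hS (hsupp _ _ _ h)
    have D1 : ∀ n B, n ≠ n0 → j0 ∉ B → opD (w n i) B = 0 := by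
      intro n B hn hj
      by_cases hB : i ∉ B ∧ B.card + 1 = r
      · exact h3 n B hn hB.1 hj hB.2
      · refine sum_eq_zero fun j hj => ?_
        by_contra h
        apply hB
        have := hsupp _ _ _ h
        rw [card_insert_of_notMem (by simpa using hj)] at this
        exact ⟨fun h' => this.1 (mem_insert_of_mem h'), this.2⟩
    have D2 : ∀ n, n ≠ n0 → opD (w n i) = 0 := by
      intro n hn
      funext B
      by_cases hB : j0 ∈ B
      · have := congrFun (opD_self (w n i)) (B.erase j0)
        rw [opD] at this
        have hc : (B.erase j0)ᶜ = insert j0 Bᶜ := by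
          ext x; simp only [mem_compl, mem_erase, mem_insert]; tauto
        rw [hc, sum_insert (by simpa using hB), insert_erase hB, sum_eq_zero, add_zero] at this
        · exact this
        · intro j hj
          apply D1 n _ hn
          simp only [mem_insert, mem_erase, not_or]
          refine ⟨?_, by tauto⟩
          rintro rfl
          exact (mem_compl.1 hj) hB
      · exact D1 n B hn hB
    have D3 : ∀ n, opD (w n i) = 0 := by
      intro n
      by_cases hn : n = n0
      · subst hn
        have := congrArg opD h2'
        rw [opD_sum, opD_zero, Finset.sum_eq_single n (fun m _ hm => D2 m hm) (by simp)] at this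
        exact this
      · exact D2 n hn
    have hD := congrFun (congrArg opD (Y0 i)) S
    rw [opY_eq, opD_sum, opD_zero, Finset.sum_apply] at hD
    have hterm : ∀ n, opD (opE (fun j => if d j = n then c i j else 0) (w n i)) S =
        (∑ j, (if d j = n then c i j else 0)) * w n i S := by
      intro n
      rw [← opD_opE, D3 n, opE_zero]; simp
    simp only [hterm] at hD
    have h2S := congrFun h2' S
    rw [Finset.sum_apply] at h2S
    have : ∑ n, ((∑ j, (if d j = n then c i j else 0)) - 1) * w n i S = 0 := by
      simp only [sub_mul, one_mul, sum_sub_distrib]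
      rw [hD, h2S]; simp
    rw [Finset.sum_eq_single (d i)] at this
    · exact (mul_eq_zero.1 this).resolve_left (sub_ne_zero.2 (G i).sum_self)
    · intro n _ hn
      rw [(G i).sum_ne n hn, sub_self, zero_mul]
    · simp
  · by_cases hk : k ∈ S
    · exact h1' _ _ _ hk
    · have := congrFun (Y0 i) (insert k S)
      rw [opY, sum_insert hk, erase_insert hk, sum_eq_zero, add_zero] at this
      · exact (mul_eq_zero.1 this).resolve_left ((G i).ne k (Ne.symm hik))
      · intro j hj
        rw [h1' _ _ _ (mem_erase.2 ⟨?_, mem_insert_self _ _⟩), mul_zero]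
        rintro rfl; exact hk hj

lemma exists_coeff (hR : ∀ a b : R, ∃ s, s ≠ a ∧ s ≠ b) (U : Finset V) (hU : U.Nonempty) :
    ∀ t : R, t ≠ 0 → ∃ c : V → R, (∀ j, c j ≠ 0) ∧ ∑ j ∈ U, c j = t := by
  induction hU using Finset.Nonempty.cons_induction with
  | singleton a => intro t ht; exact ⟨fun _ => t, fun _ => ht, by simp⟩
  | cons a s ha hs ih =>
    intro t ht
    obtain ⟨x, hx0, hxt⟩ := hR 0 t
    obtain ⟨c, hc, hsum⟩ := ih (t - x) (sub_ne_zero.2 (Ne.symm hxt))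
    refine ⟨fun j => if j = a then x else c j, ?_, ?_⟩
    · intro j; dsimp only; split_ifs
      · exact hx0
      · exact hc j
    · rw [sum_cons, if_pos rfl, sum_congr rfl (g := c), hsum]
      · ring
      · intro j hj
        rw [if_neg]; rintro rfl; exact ha hj

lemma exists_good (hR : ∀ a b : R, ∃ s, s ≠ a ∧ s ≠ b) {N K : ℕ} (d : Fin K → Fin N)
    (hd : Function.Surjective d) (i : Fin K) :
    ∃ (c : Fin K → R) (P : Finset (Fin N)) (ℓ : Fin N → Fin K), Good d i c P ℓ := by
  classical
  have hU : ∀ n : Fin N, ∃ c : Fin K → R, (∀ j, c j ≠ 0) ∧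
      (n ≠ d i → ∑ j ∈ univ.filter (fun j => j ≠ i ∧ d j = n), c j = 1) ∧
      (n = d i → ∑ j ∈ univ.filter (fun j => j ≠ i ∧ d j = n), c j ≠ 1) := by
    intro n
    by_cases hn : n = d i
    · rcases (univ.filter (fun j => j ≠ i ∧ d j = n)).eq_empty_or_nonempty with h | h
      · refine ⟨fun _ => 1, fun _ => one_ne_zero, fun h' => absurd hn h', fun _ => ?_⟩
        rw [h]; simp
      · obtain ⟨x, hx0, hx1⟩ := hR 0 1
        obtain ⟨c, hc, hs⟩ := exists_coeff hR _ h x hx0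
        exact ⟨c, hc, fun h' => absurd hn h', fun _ => hs ▸ hx1⟩
    · obtain ⟨j, hj⟩ := hd n
      have h : (univ.filter (fun j => j ≠ i ∧ d j = n)).Nonempty := by
        refine ⟨j, ?_⟩
        simp only [mem_filter, mem_univ, true_and]
        refine ⟨?_, hj⟩
        rintro rfl; exact hn hj.symm
      obtain ⟨c, hc, hs⟩ := exists_coeff hR _ h 1 one_ne_zero
      exact ⟨c, hc, fun _ => hs, fun h' => absurd h' hn⟩
  choose c hc hc1 hc2 using hU
  have hsum : ∀ n, ∑ j, (if d j = n then (if j = i then 0 else c (d j) j) else 0) =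
      ∑ j ∈ univ.filter (fun j => j ≠ i ∧ d j = n), c n j := by
    intro n
    rw [sum_filter]
    refine sum_congr rfl fun j _ => ?_
    by_cases h1 : d j = n <;> by_cases h2 : j = i <;> simp [h1, h2]
  have hl : ∀ n, ∃ l : Fin K, (∃ j, j ≠ i ∧ d j = n) → l ≠ i ∧ d l = n := by
    intro n
    by_cases h : ∃ j, j ≠ i ∧ d j = n
    · exact ⟨h.choose, fun _ => h.choose_spec⟩
    · exact ⟨i, fun h' => absurd h' h⟩
  choose ℓ hℓ using hl
  refine ⟨fun j => if j = i then 0 else c (d j) j,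
    univ.filter (fun n => ∃ j, j ≠ i ∧ d j = n), ℓ, ?_, ?_, ?_, ?_, ?_, ?_⟩
  · simp
  · intro j hj; simp only [if_neg hj]; exact hc _ _
  · intro n; simp
  · intro n hn; exact hℓ n (by simpa using hn)
  · intro n hn; rw [hsum]; exact hc1 n hn
  · rw [hsum]; exact hc2 _ rfl

/-- Index set of the symbols of one file. -/
def idxI (K r : ℕ) : Finset (Fin K × Finset (Fin K)) :=
  univ.filter (fun x => x.1 ∉ x.2 ∧ x.2.card = r)

def idx1 (N K r : ℕ) (k : Fin K) : Finset (Fin N × Fin K × Finset (Fin K)) :=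
  univ.filter (fun x => x.2.1 ∉ x.2.2 ∧ x.2.2.card = r ∧ k ∈ x.2.2)

def idx2 (K r : ℕ) (k : Fin K) : Finset (Finset (Fin K)) :=
  univ.filter (fun S => k ∉ S ∧ S.card = r)

def idx3 (N K r : ℕ) (n0 : Fin N) (k j0 : Fin K) : Finset (Fin N × Finset (Fin K)) :=
  univ.filter (fun x => x.1 ≠ n0 ∧ k ∉ x.2 ∧ j0 ∉ x.2 ∧ x.2.card + 1 = r)

def idxT (K r : ℕ) (L : Fin K → Finset (Fin K)) : Finset (Fin K × Finset (Fin K)) :=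
  univ.filter (fun x => x.2.card = r + 1 ∧ x.1 ∉ x.2 ∧ ¬ Disjoint x.2 (L x.1))

lemma card_prod_filter {α β : Type} [Fintype α] [Fintype β] [DecidableEq α] [DecidableEq β]
    (p : α × β → Prop) [DecidablePred p] :
    (univ.filter p).card = ∑ a : α, (univ.filter (fun b : β => p (a, b))).card := by
  simp only [card_filter]
  rw [← univ_product_univ, sum_product]

lemma card_avoid {K : ℕ} (D : Finset (Fin K)) (r : ℕ) :
    (univ.filter (fun S : Finset (Fin K) => Disjoint S D ∧ S.card = r)).card =
      (K - D.card).choose r := by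
  have : univ.filter (fun S : Finset (Fin K) => Disjoint S D ∧ S.card = r) =
      powersetCard r Dᶜ := by
    ext S
    simp only [mem_filter, mem_univ, true_and, mem_powersetCard, subset_compl_iff_disjoint_right]
  rw [this, card_powersetCard, card_compl, Fintype.card_fin]

lemma card_idx2 {K r : ℕ} (k : Fin K) : (idx2 K r k).card = (K - 1).choose r := by
  have := card_avoid ({k} : Finset (Fin K)) r
  simpa [idx2] using this

lemma card_idxI {K r : ℕ} : (idxI K r).card = K * (K - 1).choose r := by
  rw [idxI, card_prod_filter]
  have : ∀ i : Fin K, (univ.filter (fun S : Finset (Fin K) => i ∉ S ∧ S.card = r)).card =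
    (K - 1).choose r := fun i => card_idx2 i
  simp [this]

lemma card_idx3 {N K r : ℕ} (n0 : Fin N) (k j0 : Fin K) (h : 2 ≤ K → j0 ≠ k) (hr : r ≤ K - 1) :
    (idx3 N K r n0 k j0).card ≤
      if 1 ≤ r then (N - 1) * (K - 2).choose (r - 1) else 0 := by
  split_ifs with h1
  · have hne : j0 ≠ k := h (by omega)
    have hD : ({k, j0} : Finset (Fin K)).card = 2 := card_pair hne.symm
    have := card_avoid ({k, j0} : Finset (Fin K)) (r - 1)
    rw [hD] at this
    rw [← this]
    have hn : (univ.erase n0 : Finset (Fin N)).card = N - 1 := by simp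
    rw [← hn, ← card_product]
    apply card_le_card
    rintro ⟨n, B⟩ hx
    simp only [idx3, mem_filter, mem_univ, true_and] at hx
    simp only [mem_product, mem_erase, mem_univ, and_true, mem_filter, true_and]
    refine ⟨hx.1, ?_, by omega⟩
    simp [hx.2.1, hx.2.2.1]
  · rw [Nat.le_zero, card_eq_zero]
    apply filter_eq_empty_iff.2
    rintro x -
    omega

lemma card_idx1 {N K r : ℕ} (k : Fin K) :
    (idx1 N K r k).card = N * (r * (K - 1).choose r) := by
  have hK : 1 ≤ K := k.pos
  have h1 : (univ.filter (fun x : Fin K × Finset (Fin K) =>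
      x.1 ∉ x.2 ∧ x.2.card = r ∧ k ∈ x.2)).card = r * (K - 1).choose r := by
    -- swap the roles
    have hs : ∑ i : Fin K, (univ.filter (fun S : Finset (Fin K) =>
        i ∉ S ∧ S.card = r ∧ k ∈ S)).card =
        ∑ S : Finset (Fin K), (univ.filter (fun i : Fin K =>
        i ∉ S ∧ S.card = r ∧ k ∈ S)).card := by
      simp only [card_filter]; exact sum_comm
    rw [card_prod_filter, hs]
    have h2 : ∀ S : Finset (Fin K), (univ.filter (fun i : Fin K =>
        i ∉ S ∧ S.card = r ∧ k ∈ S)).card = if S.card = r ∧ k ∈ S then K - r else 0 := by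
      intro S
      split_ifs with h
      · have : univ.filter (fun i : Fin K => i ∉ S ∧ S.card = r ∧ k ∈ S) = Sᶜ := by
          ext i; simp [h]
        rw [this, card_compl, Fintype.card_fin, h.1]
      · rw [card_eq_zero, filter_eq_empty_iff]; tauto
    simp only [h2]
    rw [← sum_filter, sum_const, smul_eq_mul]
    have h3 : (univ.filter (fun S : Finset (Fin K) => S.card = r ∧ k ∈ S)).card +
        (K - 1).choose r = K.choose r := by
      have e0 : (powersetCard r (univ : Finset (Fin K))).card = K.choose r := by
        rw [card_powersetCard, card_univ, Fintype.card_fin]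
      rw [← card_idx2 k, ← e0,
        ← card_filter_add_card_filter_not (s := powersetCard r univ) (fun S => k ∈ S)]
      congr 2
      · ext S; simp
      · ext S; simp [idx2, and_comm]
    obtain ⟨K', rfl⟩ : ∃ K', K = K' + 1 := ⟨K - 1, by omega⟩
    rcases r with _ | r
    · simp at h3
      simp
    · rw [Nat.choose_succ_succ] at h3
      have h4 : (univ.filter (fun S : Finset (Fin (K' + 1)) => S.card = r + 1 ∧ k ∈ S)).card
        = K'.choose r := by simp only [Nat.add_sub_cancel, Nat.succ_eq_add_one] at h3; omega
      rw [h4]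
      have := Nat.choose_succ_right_eq K' r
      simp only [Nat.add_sub_cancel, Nat.add_sub_add_right]
      rw [← this, mul_comm]
  rw [idx1, card_prod_filter]
  simp only [h1]
  simp

lemma unique_count {N K : ℕ} (d : Fin K → Fin N) (hd : Function.Surjective d) :
    2 * N ≤ K + (univ.filter (fun i : Fin K => ∀ j, d j = d i → j = i)).card := by
  set Q := univ.filter (fun i : Fin K => ∀ j, d j = d i → j = i)
  have e1 := card_eq_sum_card_fiberwise (s := (univ : Finset (Fin K))) (t := univ) (f := d)
    (by simp)
  have e2 := card_eq_sum_card_fiberwise (s := Q) (t := univ) (f := d) (by simp)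
  rw [card_univ, Fintype.card_fin] at e1
  have : 2 * N = ∑ n : Fin N, 2 := by simp [mul_comm]
  suffices h : ∑ n : Fin N, 2 ≤ ∑ n : Fin N, ((univ.filter (fun j => d j = n)).card +
      (Q.filter (fun j => d j = n)).card) by
    rw [sum_add_distrib] at h
    omega
  refine sum_le_sum fun n _ => ?_
  obtain ⟨i, hi⟩ := hd n
  by_cases hQ : i ∈ Q
  · have a : 0 < (univ.filter (fun j => d j = n)).card := card_pos.2 ⟨i, by simp [hi]⟩
    have b : 0 < (Q.filter (fun j => d j = n)).card := card_pos.2 ⟨i, by simp [hi, hQ]⟩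
    omega
  · have : ∃ j, d j = d i ∧ j ≠ i := by
      simpa [Q] using hQ
    obtain ⟨j, hj, hji⟩ := this
    have : 1 < (univ.filter (fun j => d j = n)).card :=
      one_lt_card.2 ⟨i, by simp [hi], j, by simp [hj, hi], hji.symm⟩
    omega

lemma card_idxT {N K r : ℕ} (hN : 1 ≤ N) (hNK : N ≤ K) (d : Fin K → Fin N)
    (hd : Function.Surjective d)
    (c : Fin K → Fin K → R) (P : Fin K → Finset (Fin N)) (ℓ : Fin K → Fin N → Fin K)
    (G : ∀ i, Good d i (c i) (P i) (ℓ i)) :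
    2 * (idxT K r (fun i => (P i).image (ℓ i))).card ≤ transCountStar N K r := by
  set Q := univ.filter (fun i : Fin K => ∀ j, d j = d i → j = i) with hQ
  set L : Fin K → Finset (Fin K) := fun i => (P i).image (ℓ i) with hL
  have hLi : ∀ i, i ∉ L i := by
    intro i hi
    simp only [hL, mem_image] at hi
    obtain ⟨n, hn, h⟩ := hi
    exact ((G i).lead n hn).1 h
  have hLN : ∀ i, (L i).card ≤ N := fun i =>
    card_image_le.trans ((card_le_univ _).trans (by simp))
  have hLN1 : ∀ i ∈ Q, (L i).card ≤ N - 1 := by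
    intro i hi
    have : P i ⊆ univ.erase (d i) := by
      intro n hn
      rw [mem_erase]
      refine ⟨?_, mem_univ _⟩
      rintro rfl
      obtain ⟨j, hj, hj'⟩ := ((G i).memP _).1 hn
      simp only [hQ, mem_filter, mem_univ, true_and] at hi
      exact hj (hi j hj')
    refine card_image_le.trans ((card_le_card this).trans ?_)
    simp
  have hcount : ∀ i, (univ.filter (fun A : Finset (Fin K) =>
      A.card = r + 1 ∧ i ∉ A ∧ ¬ Disjoint A (L i))).card +
      (K - 1 - (L i).card).choose (r + 1) = (K - 1).choose (r + 1) := by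
    intro i
    have e1 := card_avoid (insert i (L i)) (r + 1)
    rw [card_insert_of_notMem (hLi i)] at e1
    have e2 := card_idx2 (r := r + 1) i
    rw [Nat.sub_sub, add_comm 1, ← e1, ← e2, idx2, add_comm,
      ← card_filter_add_card_filter_not
        (s := univ.filter (fun S : Finset (Fin K) => i ∉ S ∧ S.card = r + 1))
        (fun S => Disjoint S (L i))]
    congr 2
    · ext S; simp only [mem_filter, mem_univ, true_and, disjoint_insert_right]; tauto
    · ext S; simp only [mem_filter, mem_univ, true_and]; tauto
  have hT : (idxT K r L).card + ∑ i, (K - 1 - (L i).card).choose (r + 1) =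
      K * (K - 1).choose (r + 1) := by
    rw [idxT, card_prod_filter, ← sum_add_distrib]
    simp only [hcount]
    simp
  have hlow : ∑ i : Fin K, (if i ∈ Q then (K - N).choose (r + 1)
      else (K - 1 - N).choose (r + 1)) ≤ ∑ i, (K - 1 - (L i).card).choose (r + 1) := by
    refine sum_le_sum fun i _ => ?_
    split_ifs with h
    · apply Nat.choose_le_choose
      have := hLN1 i h; omega
    · apply Nat.choose_le_choose
      have := hLN i; omega
  have hsum : ∑ i : Fin K, (if i ∈ Q then (K - N).choose (r + 1)
      else (K - 1 - N).choose (r + 1)) =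
      Q.card * (K - N).choose (r + 1) + (K - Q.card) * (K - 1 - N).choose (r + 1) := by
    rw [sum_ite]
    simp only [sum_const, smul_eq_mul]
    have h1 : univ.filter (fun i => i ∈ Q) = Q := by ext; simp
    have h2 : univ.filter (fun i => i ∉ Q) = Qᶜ := by ext; simp
    rw [h1, h2, card_compl, Fintype.card_fin]
  have hQK : Q.card ≤ K := (card_le_univ Q).trans (by simp)
  have hu := unique_count d hd
  rw [← hQ] at hu
  have hmono : (K - 1 - N).choose (r + 1) ≤ (K - N).choose (r + 1) :=
    Nat.choose_le_choose _ (by omega)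
  obtain ⟨q, hq⟩ : ∃ q, Q.card = (2 * N - K) + q := ⟨Q.card - (2 * N - K), by omega⟩
  have hfin : (2 * N - K) * (K - N).choose (r + 1) +
      (K - (2 * N - K)) * (K - 1 - N).choose (r + 1) ≤
      Q.card * (K - N).choose (r + 1) + (K - Q.card) * (K - 1 - N).choose (r + 1) := by
    have : K - (2 * N - K) = (K - Q.card) + q := by omega
    rw [this, hq]
    nlinarith [Nat.mul_le_mul_left q hmono]
  unfold transCountStar
  rw [mul_assoc, mul_assoc, mul_assoc]
  omega

/-- Extension by zero. -/
def ext0 {K r : ℕ} (f : idxI K r → R) (i : Fin K) (S : Finset (Fin K)) : R :=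
  if h : (i, S) ∈ idxI K r then f ⟨(i, S), h⟩ else 0

lemma opY_sub {N K : ℕ} (d : Fin K → Fin N) (c : Fin K → R) (w w' : Fin N → Finset (Fin K) → R)
    (A : Finset (Fin K)) :
    opY d c (fun n S => w n S - w' n S) A = opY d c w A - opY d c w' A := by
  simp only [opY, mul_sub, sum_sub_distrib]

lemma opD_sub (f g : Finset V → R) (A : Finset V) :
    opD (fun S => f S - g S) A = opD f A - opD g A := by
  simp only [opD, sum_sub_distrib]

lemma main [Finite R] (hcard : Nat.card R = 4)
    (N K r : ℕ) (hN : 1 ≤ N) (hNK : N ≤ K) (hr : r ≤ K - 1) :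
    ∃ φ : Fin K → (Fin N → Fin (segCount K r) → ZMod 2) →
        (Fin (cacheCount N K r) → ZMod 2),
      ∀ d : Fin K → Fin N, Function.Surjective d →
        ∃ X : (Fin N → Fin (segCount K r) → ZMod 2) →
            (Fin (transCountStar N K r) → ZMod 2),
        ∃ ψ : Fin K → (Fin (cacheCount N K r) → ZMod 2) →
            (Fin (transCountStar N K r) → ZMod 2) →
            (Fin (segCount K r) → ZMod 2),
          ∀ (W : Fin N → Fin (segCount K r) → ZMod 2) (k : Fin K),
            ψ k (φ k W) (X W) = W (d k) := by
  classical
  have hR : ∀ a b : R, ∃ s, s ≠ a ∧ s ≠ b := by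
    intro a b
    by_contra! h
    have := Fintype.ofFinite R
    have h2 : (univ : Finset R) ⊆ {a, b} := by
      intro s _
      simp only [mem_insert, mem_singleton]
      by_cases hs : s = a
      · exact Or.inl hs
      · exact Or.inr (h s hs)
    have h3 := (card_le_card h2).trans card_le_two
    rw [card_univ, ← Nat.card_eq_fintype_card, hcard] at h3
    omega
  have hcf : ∀ {α : Type} (J : Finset α), Nat.card (J → R) = 2 ^ (2 * J.card) := by
    intro α J
    rw [Nat.card_fun, hcard, Nat.card_eq_fintype_card, Fintype.card_coe, pow_mul]; norm_num
  have hj0 : ∀ k : Fin K, ∃ j : Fin K, 2 ≤ K → j ≠ k := by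
    intro k
    by_cases h : 2 ≤ K
    · have : Nontrivial (Fin K) := Fin.nontrivial_iff_two_le.2 h
      obtain ⟨j, hj⟩ := exists_ne k
      exact ⟨j, fun _ => hj⟩
    · exact ⟨k, fun h' => absurd h' h⟩
  choose j0 hj0 using hj0
  let n0 : Fin N := ⟨0, hN⟩
  have hgood : ∀ d : Fin K → Fin N, ∃ (c : Fin K → Fin K → R) (P : Fin K → Finset (Fin N))
      (ℓ : Fin K → Fin N → Fin K), Function.Surjective d →
      ∀ i, Good d i (c i) (P i) (ℓ i) := by
    intro d
    by_cases hd : Function.Surjective d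
    · choose c P ℓ G using exists_good hR d hd
      exact ⟨c, P, ℓ, fun _ => G⟩
    · exact ⟨fun _ _ => 0, fun _ => ∅, fun i _ => i, fun h => absurd h hd⟩
  choose c P ℓ G using hgood
  refine reduction (S := idxI K r → R) ?_
    (fun k => (idx1 N K r k → R) × (idx2 K r k → R) × (idx3 N K r n0 k (j0 k) → R)) ?_
    (fun k W => (fun x => ext0 (W x.1.1) x.1.2.1 x.1.2.2,
      fun S => ∑ n, ext0 (W n) k S.1,
      fun x => opD (ext0 (W x.1.1) k) x.1.2))
    (fun d => idxT K r (fun i => (P d i).image (ℓ d i)) → R) ?_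
    (fun d W x => opY d (c d x.1.1) (fun n => ext0 (W n) x.1.1) x.1.2) ?_
  · rw [hcf, card_idxI, segCount, mul_assoc]
  · intro k
    rw [Nat.card_prod, Nat.card_prod, hcf, hcf, hcf, ← pow_add, ← pow_add]
    apply Nat.pow_le_pow_right (by norm_num)
    rw [card_idx1, card_idx2, cacheCount]
    have h3 := card_idx3 n0 k (j0 k) (hj0 k) hr
    have e1 : 2 * (N * (r * (K - 1).choose r)) = 2 * N * r * (K - 1).choose r := by ring
    rw [e1]
    split_ifs at h3 ⊢ with h
    · rw [mul_assoc 2 (N - 1)]; omega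
    · omega
  · intro d hd
    rw [hcf]
    exact Nat.pow_le_pow_right (by norm_num) (card_idxT hN hNK d hd _ _ _ (G d hd))
  · intro d hd k W W' hφ hX
    simp only [Prod.mk.injEq] at hφ
    obtain ⟨hA, hB, hC⟩ := hφ
    have hz := core (r := r) d k (j0 k) n0 (c d) (P d) (ℓ d) (G d hd)
      (fun n i S => ext0 (W n) i S - ext0 (W' n) i S) ?_ ?_ ?_ ?_ ?_
    · funext ⟨⟨i, S⟩, h⟩
      have := hz i S
      simp only [ext0, dif_pos h] at this
      exact sub_eq_zero.1 this
    · intro n i S h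
      by_contra h'
      have : (i, S) ∉ idxI K r := by simpa [idxI] using h'
      simp [ext0, this] at h
    · intro n i S h1 h2 h3
      exact sub_eq_zero.2 (congrFun hA ⟨(n, i, S), by simp [idx1, h1, h2, h3]⟩)
    · intro S h1 h2
      rw [sum_sub_distrib]
      exact sub_eq_zero.2 (congrFun hB ⟨S, by simp [idx2, h1, h2]⟩)
    · intro n B h1 h2 h3 h4
      rw [opD_sub]
      exact sub_eq_zero.2 (congrFun hC ⟨(n, B), by simp [idx3, h1, h2, h3, h4]⟩)
    · intro i A h1 h2 h3
      rw [opY_sub]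
      exact sub_eq_zero.2 (congrFun hX ⟨(i, A), by simp only [idxT, mem_filter, mem_univ, true_and]; exact ⟨h1, h2, h3⟩⟩)

end CC

/-- Theorem 2: achievability for the fully demanded system
(every surjective demand vector is served). -/
theorem fully_demanded_achievability
    (N K r : ℕ) (hN : 1 ≤ N) (hNK : N ≤ K) (hr : r ≤ K - 1) :
    ∃ φ : Fin K → (Fin N → Fin (segCount K r) → ZMod 2) →
        (Fin (cacheCount N K r) → ZMod 2),
      ∀ d : Fin K → Fin N, Function.Surjective d →
        ∃ X : (Fin N → Fin (segCount K r) → ZMod 2) →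
            (Fin (transCountStar N K r) → ZMod 2),
        ∃ ψ : Fin K → (Fin (cacheCount N K r) → ZMod 2) →
            (Fin (transCountStar N K r) → ZMod 2) →
            (Fin (segCount K r) → ZMod 2),
          ∀ (W : Fin N → Fin (segCount K r) → ZMod 2) (k : Fin K),
            ψ k (φ k W) (X W) = W (d k) := by
  have hc : Nat.card (GaloisField 2 2) = 4 := by
    rw [GaloisField.card 2 2 (by norm_num)]; norm_num
  exact CC.main (R := GaloisField 2 2) hc N K r hN hNK hr
end
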